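/- arXiv:1403.2395 — 3 statements merged into one kernel-verified Lean document; each statement's English description precedes it below -/
import Mathlib

section
/- Suppose the kernel zigzag module associated to the data (H_i, f_i, Δ_i) is isomorphic, as a zigzag module, to a finite direct sum ⊕_{m∈M} I[a_m, b_m] of interval modules. Then for all 0 ≤ i ≤ j ≤ N, dim_k P^{i,j} equals the number of indices m ∈ M with a_m ≤ 2i and b_m ≥ 2j (i.e., the number of bars in the associated barcode containing the interval [i,j]). -/
/-!
Setting: a field `k`, finite-dimensional `k`-vector spaces `H 0, …, H N` with
linear maps `f i : H i → H (i+1)`, and for each `i` a linear map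
`Δ i : H i → T i`.

`compF f i d : H i →ₗ H (i+d)` is the composite `f^{i,i+d}`, and `pers f Δ i d`
is the `Δ`-persistent group
`P^{i,i+d} = f^{i,i+d}( ⋂_{e=0}^{d} ker (Δ_{i+e} ∘ f^{i,i+e}) ) ⊆ H (i+d)`.

The kernel zigzag module is
`V 0 ←ι− W 0 −→ V 1 ←ι− W 1 −→ ⋯ −→ V N`, where `V i = ker Δ_i`,
`W i = ker Δ_i ⊓ ker (Δ_{i+1} ∘ f_i)`, the backward maps are the inclusions
`W i ⊆ V i` and the forward maps are the restrictions of `f i`.  Its `2N+1`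
slots are indexed by `0, …, 2N`, slot `2i` being `V i` and slot `2i+1` being
`W i`.

A finite direct sum of interval modules `⊕_{m} I[a m, b m]` is encoded
slot-wise: its value at slot `s` is `IntervalSlot k M a b s`, the space of
functions `{m // a m ≤ s ∧ s ≤ b m} → k`, and its connecting map between
adjacent slots `s` and `t` is `intervalMap k M a b s t`, which is the identity
on the component of each `m` whose interval `[a m, b m]` contains both slots,
and zero otherwise.

An isomorphism of zigzag modules is a family of linear isomorphisms, one at
each slot, commuting with all connecting maps.
-/

variable (k : Type*) [Field k]

/-- The slot-`s` component of the direct sum of intervals `⊕_{m} I[a m, b m]`. -/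
abbrev IntervalSlot (M : ℕ) (a b : Fin M → ℕ) (s : ℕ) : Type _ :=
  {m : Fin M // a m ≤ s ∧ s ≤ b m} → k

/-- The connecting map of `⊕_{m} I[a m, b m]` from slot `s` to an adjacent slot
`t`: identity on each component whose interval contains both slots, zero
otherwise. -/
def intervalMap (M : ℕ) (a b : Fin M → ℕ) (s t : ℕ) :
    IntervalSlot k M a b s →ₗ[k] IntervalSlot k M a b t where
  toFun x := fun m => if h : a m.1 ≤ s ∧ s ≤ b m.1 then x ⟨m.1, h⟩ else 0
  map_add' x y := by
    funext m
    by_cases h : a m.1 ≤ s ∧ s ≤ b m.1 <;> simp [h]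
  map_smul' c x := by
    funext m
    by_cases h : a m.1 ≤ s ∧ s ≤ b m.1 <;> simp [h]

variable (H : ℕ → Type*) [∀ i, AddCommGroup (H i)] [∀ i, Module k (H i)]
  [∀ i, FiniteDimensional k (H i)]
variable (T : ℕ → Type*) [∀ i, AddCommGroup (T i)] [∀ i, Module k (T i)]

/-- The composite `f^{i,i+d} : H i →ₗ[k] H (i+d)`. -/
def compF (f : ∀ i, H i →ₗ[k] H (i + 1)) (i : ℕ) : (d : ℕ) → H i →ₗ[k] H (i + d)
  | 0 => LinearMap.id
  | d + 1 => (f (i + d)).comp (compF f i d)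

/-- The `Δ`-persistent group `P^{i,i+d}`. -/
def pers (f : ∀ i, H i →ₗ[k] H (i + 1)) (Δ : ∀ i, H i →ₗ[k] T i) (i d : ℕ) :
    Submodule k (H (i + d)) :=
  Submodule.map (compF k H f i d)
    (⨅ e : Fin (d + 1), LinearMap.ker ((Δ (i + (e : ℕ))).comp (compF k H f i (e : ℕ))))

/-- `W i = ker Δ_i ⊓ ker (Δ_{i+1} ∘ f_i)`. -/
def Wsub (f : ∀ i, H i →ₗ[k] H (i + 1)) (Δ : ∀ i, H i →ₗ[k] T i) (i : ℕ) :
    Submodule k (H i) :=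
  LinearMap.ker (Δ i) ⊓ LinearMap.ker ((Δ (i + 1)).comp (f i))

/-- The backward map of the kernel zigzag module: the inclusion `W i ⊆ V i`. -/
def inclWV (f : ∀ i, H i →ₗ[k] H (i + 1)) (Δ : ∀ i, H i →ₗ[k] T i) (i : ℕ) :
    ↥(Wsub k H T f Δ i) →ₗ[k] ↥(LinearMap.ker (Δ i)) :=
  Submodule.inclusion inf_le_left

/-- The forward map of the kernel zigzag module: the restriction of `f i` to a
map `W i → V (i+1)`. -/
def fresWV (f : ∀ i, H i →ₗ[k] H (i + 1)) (Δ : ∀ i, H i →ₗ[k] T i) (i : ℕ) :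
    ↥(Wsub k H T f Δ i) →ₗ[k] ↥(LinearMap.ker (Δ (i + 1))) :=
  (f i).restrict (fun x hx => by
    have h2 : x ∈ LinearMap.ker ((Δ (i + 1)).comp (f i)) := hx.2
    rw [LinearMap.mem_ker, LinearMap.comp_apply] at h2
    exact LinearMap.mem_ker.2 h2)

theorem mem_pers {f : ∀ i, H i →ₗ[k] H (i + 1)} {Δ : ∀ i, H i →ₗ[k] T i} {i d : ℕ}
    {y : H (i + d)} :
    y ∈ pers k H T f Δ i d ↔
      ∃ x : H i, (∀ e ≤ d, Δ (i + e) (compF k H f i e x) = 0) ∧ compF k H f i d x = y := by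
  simp only [pers, Submodule.mem_map, Submodule.mem_iInf, LinearMap.mem_ker,
    LinearMap.comp_apply, Fin.forall_iff, Nat.lt_succ_iff]

theorem mem_pers_zero {f : ∀ i, H i →ₗ[k] H (i + 1)} {Δ : ∀ i, H i →ₗ[k] T i} {i : ℕ}
    {y : H i} : y ∈ pers k H T f Δ i 0 ↔ Δ i y = 0 := by
  rw [mem_pers]
  constructor
  · rintro ⟨x, hx, rfl⟩
    exact hx 0 le_rfl
  · intro hy
    refine ⟨y, fun e he => ?_, rfl⟩
    obtain rfl := Nat.le_zero.mp he
    exact hy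

theorem mem_pers_succ {f : ∀ i, H i →ₗ[k] H (i + 1)} {Δ : ∀ i, H i →ₗ[k] T i} {i d : ℕ}
    {y : H (i + d + 1)} :
    y ∈ pers k H T f Δ i (d + 1) ↔
      Δ (i + d + 1) y = 0 ∧ ∃ x ∈ pers k H T f Δ i d, f (i + d) x = y := by
  constructor
  · intro hy
    obtain ⟨x, hx, rfl⟩ := (mem_pers k H T).1 hy
    exact ⟨hx (d + 1) le_rfl, compF k H f i d x,
      (mem_pers k H T).2 ⟨x, fun e he => hx e (by omega), rfl⟩, rfl⟩
  · rintro ⟨hy, z, hz, rfl⟩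
    obtain ⟨x, hx, rfl⟩ := (mem_pers k H T).1 hz
    refine (mem_pers k H T).2 ⟨x, fun e he => ?_, rfl⟩
    rcases Nat.le_succ_iff.1 he with he | rfl
    · exact hx e he
    · exact hy

theorem pers_le_ker (f : ∀ i, H i →ₗ[k] H (i + 1)) (Δ : ∀ i, H i →ₗ[k] T i) (i d : ℕ) :
    pers k H T f Δ i d ≤ LinearMap.ker (Δ (i + d)) := by
  intro y hy
  obtain ⟨x, hx, rfl⟩ := (mem_pers k H T).1 hy
  exact hx d le_rfl

theorem intervalMap_apply_of_mem {M : ℕ} {a b : Fin M → ℕ} {s t : ℕ}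
    (x : IntervalSlot k M a b s) (m : {m : Fin M // a m ≤ t ∧ t ≤ b m})
    (hm : a m.1 ≤ s ∧ s ≤ b m.1) : intervalMap k M a b s t x m = x ⟨m.1, hm⟩ :=
  dif_pos hm

theorem intervalMap_apply_of_notMem {M : ℕ} {a b : Fin M → ℕ} {s t : ℕ}
    (x : IntervalSlot k M a b s) (m : {m : Fin M // a m ≤ t ∧ t ≤ b m})
    (hm : ¬(a m.1 ≤ s ∧ s ≤ b m.1)) : intervalMap k M a b s t x m = 0 :=
  dif_neg hm

/-- If the connecting map from slot `s + 1` to slot `s` is injective, no interval starts at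
slot `s + 1`. -/
theorem left_end_le_of_injective_intervalMap {M : ℕ} {a b : Fin M → ℕ} {s : ℕ}
    (hinj : Function.Injective (intervalMap k M a b (s + 1) s))
    {m : Fin M} (hm : a m ≤ s + 1 ∧ s + 1 ≤ b m) : a m ≤ s := by
  classical
  by_contra hlt
  have hzero : (Pi.single ⟨m, hm⟩ 1 : IntervalSlot k M a b (s + 1)) = 0 := by
    apply hinj
    rw [map_zero]
    funext n
    have hne : n.1 ≠ m := fun h => hlt (h ▸ n.2.1)
    simp [intervalMap, hne]
  simpa using congrFun hzero ⟨m, hm⟩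

/-- Under an isomorphism of the kernel zigzag with a sum of intervals, the persistent group
`P^{i,i+d}` corresponds to the vectors supported on the intervals that start no later than
slot `2 * i`. -/
theorem mem_pers_iff_support
    {N : ℕ} {f : ∀ i, H i →ₗ[k] H (i + 1)} {Δ : ∀ i, H i →ₗ[k] T i}
    {M : ℕ} {a b : Fin M → ℕ}
    (φV : ∀ i, i ≤ N → (↥(LinearMap.ker (Δ i)) ≃ₗ[k] IntervalSlot k M a b (2 * i)))
    (φW : ∀ i, i < N → (↥(Wsub k H T f Δ i) ≃ₗ[k] IntervalSlot k M a b (2 * i + 1)))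
    (hback : ∀ i (h : i < N),
      (φV i h.le).toLinearMap ∘ₗ inclWV k H T f Δ i =
        intervalMap k M a b (2 * i + 1) (2 * i) ∘ₗ (φW i h).toLinearMap)
    (hfwd : ∀ i (h : i < N),
      (φV (i + 1) h).toLinearMap ∘ₗ fresWV k H T f Δ i =
        intervalMap k M a b (2 * i + 1) (2 * i + 2) ∘ₗ (φW i h).toLinearMap)
    (i d : ℕ) (hd : i + d ≤ N) (y : LinearMap.ker (Δ (i + d))) :
    y.1 ∈ pers k H T f Δ i d ↔ ∀ m, φV (i + d) hd y m ≠ 0 → a m.1 ≤ 2 * i := by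
  induction d with
  | zero => exact ⟨fun _ m _ => m.2.1, fun _ => (mem_pers_zero k H T).2 y.2⟩
  | succ d ih =>
    have hlt : i + d < N := hd
    have hinj : Function.Injective (intervalMap k M a b (2 * (i + d) + 1) (2 * (i + d))) := by
      have hcomp : Function.Injective
          (intervalMap k M a b (2 * (i + d) + 1) (2 * (i + d)) ∘ₗ (φW _ hlt).toLinearMap) := by
        rw [← hback]
        exact (φV _ hlt.le).injective.comp (Submodule.inclusion_injective _)
      intro x x' hx
      obtain ⟨w, rfl⟩ := (φW _ hlt).surjective x
      obtain ⟨w', rfl⟩ := (φW _ hlt).surjective x'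
      exact congrArg _ (hcomp hx)
    have hincl (w : Wsub k H T f Δ (i + d)) :
        w.1 ∈ pers k H T f Δ i d ↔ ∀ m, φW _ hlt w m ≠ 0 → a m.1 ≤ 2 * i := by
      have hw := LinearMap.congr_fun (hback _ hlt) w
      simp only [LinearMap.comp_apply, LinearEquiv.coe_coe] at hw
      rw [show w.1 = (inclWV k H T f Δ (i + d) w).1 from rfl, ih hlt.le, hw]
      constructor
      · intro h m hm
        have ha := left_end_le_of_injective_intervalMap k hinj m.2
        refine h ⟨m.1, ha, by have := m.2.2; omega⟩ ?_
        exact (intervalMap_apply_of_mem k _ ⟨m.1, _⟩ m.2).trans_ne hm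
      · intro h m hm
        by_cases hm' : a m.1 ≤ 2 * (i + d) + 1 ∧ 2 * (i + d) + 1 ≤ b m.1
        · exact h ⟨m.1, hm'⟩ (by rwa [intervalMap_apply_of_mem k _ _ hm'] at hm)
        · exact absurd (intervalMap_apply_of_notMem k _ m hm') hm
    have hval (w : Wsub k H T f Δ (i + d)) :
        φV (i + d + 1) hd (fresWV k H T f Δ (i + d) w) =
          intervalMap k M a b (2 * (i + d) + 1) (2 * (i + d) + 2) (φW _ hlt w) :=
      LinearMap.congr_fun (hfwd _ hlt) w
    constructor
    · intro hy m hm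
      obtain ⟨hy0, x, hx, hxy⟩ := (mem_pers_succ k H T).1 hy
      have hxW : x ∈ Wsub k H T f Δ (i + d) :=
        ⟨pers_le_ker k H T f Δ i d hx, (congrArg (Δ (i + d + 1)) hxy).trans hy0⟩
      have hyw : y = fresWV k H T f Δ (i + d) ⟨x, hxW⟩ := Subtype.ext hxy.symm
      have hm1 : intervalMap k M a b (2 * (i + d) + 1) (2 * (i + d) + 2)
          (φW _ hlt ⟨x, hxW⟩) m ≠ 0 := by
        rw [← hval, ← hyw]; exact hm
      by_cases hm' : a m.1 ≤ 2 * (i + d) + 1 ∧ 2 * (i + d) + 1 ≤ b m.1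
      · exact (hincl ⟨x, hxW⟩).1 hx ⟨m.1, hm'⟩
          ((intervalMap_apply_of_mem k _ m hm').symm.trans_ne hm1)
      · exact absurd (intervalMap_apply_of_notMem k _ m hm') hm1
    · intro h
      set z : IntervalSlot k M a b (2 * (i + d) + 2) := φV (i + d + 1) hd y
      obtain ⟨w, hw⟩ := (φW _ hlt).surjective
        (intervalMap k M a b (2 * (i + d) + 2) (2 * (i + d) + 1) z)
      have hwy : fresWV k H T f Δ (i + d) w = y := by
        apply (φV (i + d + 1) hd).injective
        rw [hval, hw]
        funext m
        have hm2 : a m.1 ≤ 2 * (i + d) + 2 ∧ 2 * (i + d) + 2 ≤ b m.1 := m.2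
        change _ = z m
        by_cases hzm : z m = 0
        · rw [hzm]
          simp only [intervalMap, LinearMap.coe_mk, AddHom.coe_mk]
          split_ifs
          · exact hzm
          · rfl
        · have ham : a m.1 ≤ 2 * i := h m hzm
          have hm1 : a m.1 ≤ 2 * (i + d) + 1 ∧ 2 * (i + d) + 1 ≤ b m.1 := by omega
          rw [intervalMap_apply_of_mem k _ m hm1, intervalMap_apply_of_mem k _ ⟨m.1, hm1⟩ hm2]
      refine (mem_pers_succ k H T).2 ⟨y.2, w.1, (hincl w).2 fun m hm => ?_,
        congrArg Subtype.val hwy⟩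
      rw [hw] at hm
      by_cases hm' : a m.1 ≤ 2 * (i + d) + 2 ∧ 2 * (i + d) + 2 ≤ b m.1
      · refine h ⟨m.1, hm'⟩ ?_
        rwa [intervalMap_apply_of_mem k _ m hm'] at hm
      · exact absurd (intervalMap_apply_of_notMem k _ m hm') hm

/-- if the kernel zigzag module is isomorphic, as a zigzag module,
to a finite direct sum `⊕_{m} I[a m, b m]` of interval modules, then for all
`0 ≤ i ≤ j ≤ N` (`j = i + d`), `dim_k P^{i,j}` equals the number of `m` with
`a m ≤ 2i` and `b m ≥ 2j`, i.e. the number of bars containing `[i,j]`. -/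
theorem finrank_pers_eq_card_bars
    (N : ℕ) (f : ∀ i, H i →ₗ[k] H (i + 1)) (Δ : ∀ i, H i →ₗ[k] T i)
    (M : ℕ) (a b : Fin M → ℕ) (hab : ∀ m, a m ≤ b m) (hb : ∀ m, b m ≤ 2 * N)
    (φV : ∀ i, i ≤ N → (↥(LinearMap.ker (Δ i)) ≃ₗ[k] IntervalSlot k M a b (2 * i)))
    (φW : ∀ i, i < N → (↥(Wsub k H T f Δ i) ≃ₗ[k] IntervalSlot k M a b (2 * i + 1)))
    (hback : ∀ i (h : i < N),
      (φV i h.le).toLinearMap ∘ₗ inclWV k H T f Δ i =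
        intervalMap k M a b (2 * i + 1) (2 * i) ∘ₗ (φW i h).toLinearMap)
    (hfwd : ∀ i (h : i < N),
      (φV (i + 1) h).toLinearMap ∘ₗ fresWV k H T f Δ i =
        intervalMap k M a b (2 * i + 1) (2 * i + 2) ∘ₗ (φW i h).toLinearMap) :
    ∀ i d : ℕ, i + d ≤ N →
      Module.finrank k (pers k H T f Δ i d) =
        (Finset.univ.filter fun m : Fin M => a m ≤ 2 * i ∧ 2 * (i + d) ≤ b m).card := by
  intro i d hd
  let incl : {m : Fin M // a m ≤ 2 * i ∧ 2 * (i + d) ≤ b m} →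
      {m : Fin M // a m ≤ 2 * (i + d) ∧ 2 * (i + d) ≤ b m} :=
    fun m => ⟨m.1, by have := m.2.1; omega, m.2.2⟩
  have hincl : Function.Injective incl :=
    fun m n h => Subtype.ext (congrArg (fun t => t.1) h)
  let e : ({m : Fin M // a m ≤ 2 * i ∧ 2 * (i + d) ≤ b m} → k) →ₗ[k] H (i + d) :=
    (LinearMap.ker (Δ (i + d))).subtype ∘ₗ (φV (i + d) hd).symm.toLinearMap ∘ₗ
      Function.ExtendByZero.linearMap k incl
  have he : Function.Injective e :=
    (Submodule.injective_subtype _).comp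
      ((φV (i + d) hd).symm.injective.comp (Function.extend_injective hincl 0))
  have hrange : LinearMap.range e = pers k H T f Δ i d := by
    ext y
    constructor
    · rintro ⟨x, rfl⟩
      refine (mem_pers_iff_support k H T φV φW hback hfwd i d hd
        ((φV (i + d) hd).symm (Function.ExtendByZero.linearMap k incl x))).2 fun m hm => ?_
      rw [LinearEquiv.apply_symm_apply] at hm
      by_cases hex : ∃ n, incl n = m
      · obtain ⟨n, rfl⟩ := hex
        exact n.2.1
      · exact absurd (Function.extend_apply' x (fun _ => 0) m hex) hm
    · intro hy
      have hyk := pers_le_ker k H T f Δ i d hy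
      have hsupp :=
        (mem_pers_iff_support k H T φV φW hback hfwd i d hd ⟨y, hyk⟩).1 hy
      refine ⟨φV (i + d) hd ⟨y, hyk⟩ ∘ incl, ?_⟩
      have hext : Function.extend incl (φV (i + d) hd ⟨y, hyk⟩ ∘ incl) 0 =
          φV (i + d) hd ⟨y, hyk⟩ := by
        funext m
        by_cases hex : ∃ n, incl n = m
        · obtain ⟨n, rfl⟩ := hex
          exact hincl.extend_apply _ _ n
        · rw [Function.extend_apply' _ _ _ hex]
          by_contra hne
          exact hex ⟨⟨m.1, hsupp m (Ne.symm hne), m.2.2⟩, rfl⟩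
      change ((φV (i + d) hd).symm (Function.extend incl (φV (i + d) hd ⟨y, hyk⟩ ∘ incl) 0) :
        H (i + d)) = y
      rw [hext, LinearEquiv.symm_apply_apply]
  rw [← hrange, LinearMap.finrank_range_of_inj he, Module.finrank_fintype_fun_eq_card,
    Fintype.card_subtype]
end

section
/- Suppose the kernel zigzag module associated to the data (H_i, f_i, Δ_i) is isomorphic, as a zigzag module, to a finite direct sum ⊕_{m∈M} I[a_m, b_m] of interval modules. Then for all 0 ≤ i ≤ j ≤ N, dim_k P^{i,j} ≤ #{m ∈ M : a_m ≤ 2i and b_m ≥ 2j}. -/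
/-!
Setting: a field `k`, finite-dimensional `k`-vector spaces `H 0, …, H N` with
linear maps `f i : H i → H (i+1)`, and for each `i` a linear map
`Δ i : H i → T i`.

`compF f i d : H i →ₗ H (i+d)` is the composite `f^{i,i+d}`, and `pers f Δ i d`
is the `Δ`-persistent group
`P^{i,i+d} = f^{i,i+d}( ⋂_{e=0}^{d} ker (Δ_{i+e} ∘ f^{i,i+e}) ) ⊆ H (i+d)`.

The kernel zigzag module is
`V 0 ←ι− W 0 −→ V 1 ←ι− W 1 −→ ⋯ −→ V N`, where `V i = ker Δ_i`,
`W i = ker Δ_i ⊓ ker (Δ_{i+1} ∘ f_i)`, the backward maps are the inclusions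
`W i ⊆ V i` and the forward maps are the restrictions of `f i`.  Its `2N+1`
slots are indexed by `0, …, 2N`, slot `2i` being `V i` and slot `2i+1` being
`W i`.

A finite direct sum of interval modules `⊕_{m} I[a m, b m]` is encoded
slot-wise: its value at slot `s` is `IntervalSlot k M a b s`, the space of
functions `{m // a m ≤ s ∧ s ≤ b m} → k`, and its connecting map between
adjacent slots `s` and `t` is `intervalMap k M a b s t`, which is the identity
on the component of each `m` whose interval `[a m, b m]` contains both slots,
and zero otherwise.

An isomorphism of zigzag modules is a family of linear isomorphisms, one at
each slot, commuting with all connecting maps.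
-/

variable (k : Type*) [Field k]

variable (H : ℕ → Type*) [∀ i, AddCommGroup (H i)] [∀ i, Module k (H i)]
  [∀ i, FiniteDimensional k (H i)]
variable (T : ℕ → Type*) [∀ i, AddCommGroup (T i)] [∀ i, Module k (T i)]

/-- No bar starts at a slot `2i+1`, since the backward map `W i → V i` is injective. -/
theorem left_endpoint_ne_odd
    (f : ∀ i, H i →ₗ[k] H (i + 1)) (Δ : ∀ i, H i →ₗ[k] T i)
    (M : ℕ) (a b : Fin M → ℕ) (hab : ∀ m, a m ≤ b m) (i : ℕ)
    (φV : ↥(LinearMap.ker (Δ i)) ≃ₗ[k] IntervalSlot k M a b (2 * i))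
    (φW : ↥(Wsub k H T f Δ i) ≃ₗ[k] IntervalSlot k M a b (2 * i + 1))
    (hback : φV.toLinearMap ∘ₗ inclWV k H T f Δ i =
      intervalMap k M a b (2 * i + 1) (2 * i) ∘ₗ φW.toLinearMap) (m : Fin M) :
    a m ≠ 2 * i + 1 := by
  intro hm
  have hmem : a m ≤ 2 * i + 1 ∧ 2 * i + 1 ≤ b m := ⟨hm.le, hm ▸ hab m⟩
  let v : IntervalSlot k M a b (2 * i + 1) := Pi.single ⟨m, hmem⟩ 1
  have hzero : intervalMap k M a b (2 * i + 1) (2 * i) v = 0 := by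
    funext n
    have hn : n.1 ≠ m := fun h => by
      have := n.2.1
      rw [h] at this
      omega
    simp [intervalMap, v, Subtype.ext_iff, hn]
  have happly := LinearMap.congr_fun hback (φW.symm v)
  simp only [LinearMap.comp_apply, LinearEquiv.coe_coe, LinearEquiv.apply_symm_apply, hzero]
    at happly
  have hincl : inclWV k H T f Δ i (φW.symm v) = 0 := by simpa using happly
  have hsymm : φW.symm v = 0 := Subtype.ext (Subtype.ext_iff.1 hincl :)
  have hv : v = 0 := by simpa using hsymm
  simpa [v] using congrFun hv ⟨m, hmem⟩

/-- If `x` and its images up to index `i+e` lie in the kernels of the `Δ`'s, then the coordinates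
of `f^{i,i+e} x` along the bars starting after slot `2i` vanish. -/
theorem coord_compF_eq_zero
    (N : ℕ) (f : ∀ i, H i →ₗ[k] H (i + 1)) (Δ : ∀ i, H i →ₗ[k] T i)
    (M : ℕ) (a b : Fin M → ℕ) (hab : ∀ m, a m ≤ b m)
    (φV : ∀ i, i ≤ N → (↥(LinearMap.ker (Δ i)) ≃ₗ[k] IntervalSlot k M a b (2 * i)))
    (φW : ∀ i, i < N → (↥(Wsub k H T f Δ i) ≃ₗ[k] IntervalSlot k M a b (2 * i + 1)))
    (hback : ∀ i (h : i < N),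
      (φV i h.le).toLinearMap ∘ₗ inclWV k H T f Δ i =
        intervalMap k M a b (2 * i + 1) (2 * i) ∘ₗ (φW i h).toLinearMap)
    (hfwd : ∀ i (h : i < N),
      (φV (i + 1) h).toLinearMap ∘ₗ fresWV k H T f Δ i =
        intervalMap k M a b (2 * i + 1) (2 * i + 2) ∘ₗ (φW i h).toLinearMap)
    (i : ℕ) (x : H i) (e : ℕ) (he : i + e ≤ N)
    (hx : ∀ e' ≤ e, compF k H f i e' x ∈ LinearMap.ker (Δ (i + e')))
    (m : {m : Fin M // a m ≤ 2 * (i + e) ∧ 2 * (i + e) ≤ b m}) (hm : 2 * i < a m.1) :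
    φV (i + e) he ⟨compF k H f i e x, hx e le_rfl⟩ m = 0 := by
  induction e with
  | zero => exact absurd m.2.1 (by simpa using hm)
  | succ e ih =>
    have hlt : i + e < N := he
    let w : ↥(Wsub k H T f Δ (i + e)) :=
      ⟨compF k H f i e x, hx e (Nat.le_succ e), hx (e + 1) le_rfl⟩
    have hforward : φV (i + (e + 1)) he ⟨compF k H f i (e + 1) x, hx (e + 1) le_rfl⟩ m =
        intervalMap k M a b (2 * (i + e) + 1) (2 * (i + e) + 2) (φW (i + e) hlt w) m :=
      congrFun (LinearMap.congr_fun (hfwd (i + e) hlt) w) m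
    rw [hforward]
    by_cases h : a m.1 ≤ 2 * (i + e) + 1 ∧ 2 * (i + e) + 1 ≤ b m.1
    · have hne := left_endpoint_ne_odd k H T f Δ M a b hab (i + e) (φV _ hlt.le) (φW _ hlt)
        (hback _ hlt) m.1
      have hmem : a m.1 ≤ 2 * (i + e) ∧ 2 * (i + e) ≤ b m.1 := by omega
      have hbackward : φV (i + e) hlt.le ⟨compF k H f i e x, hx e (Nat.le_succ e)⟩ ⟨m.1, hmem⟩ =
          intervalMap k M a b (2 * (i + e) + 1) (2 * (i + e)) (φW (i + e) hlt w) ⟨m.1, hmem⟩ :=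
        congrFun (LinearMap.congr_fun (hback (i + e) hlt) w) ⟨m.1, hmem⟩
      rw [ih hlt.le (fun e' he' => hx e' (Nat.le_succ_of_le he')) ⟨m.1, hmem⟩ hm] at hbackward
      simpa [intervalMap, h] using hbackward.symm
    · exact dif_neg h

/-- if the kernel zigzag module is isomorphic, as a zigzag module,
to a finite direct sum `⊕_{m} I[a m, b m]` of interval modules, then for all
`0 ≤ i ≤ j ≤ N` (`j = i + d`), `dim_k P^{i,j}` is at most the number of `m` with
`a m ≤ 2i` and `b m ≥ 2j`,  -/
theorem finrank_pers_le_card_bars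
    (N : ℕ) (f : ∀ i, H i →ₗ[k] H (i + 1)) (Δ : ∀ i, H i →ₗ[k] T i)
    (M : ℕ) (a b : Fin M → ℕ) (hab : ∀ m, a m ≤ b m) (hb : ∀ m, b m ≤ 2 * N)
    (φV : ∀ i, i ≤ N → (↥(LinearMap.ker (Δ i)) ≃ₗ[k] IntervalSlot k M a b (2 * i)))
    (φW : ∀ i, i < N → (↥(Wsub k H T f Δ i) ≃ₗ[k] IntervalSlot k M a b (2 * i + 1)))
    (hback : ∀ i (h : i < N),
      (φV i h.le).toLinearMap ∘ₗ inclWV k H T f Δ i =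
        intervalMap k M a b (2 * i + 1) (2 * i) ∘ₗ (φW i h).toLinearMap)
    (hfwd : ∀ i (h : i < N),
      (φV (i + 1) h).toLinearMap ∘ₗ fresWV k H T f Δ i =
        intervalMap k M a b (2 * i + 1) (2 * i + 2) ∘ₗ (φW i h).toLinearMap) :
    ∀ i d : ℕ, i + d ≤ N →
      Module.finrank k (pers k H T f Δ i d) ≤
        (Finset.univ.filter fun m : Fin M => a m ≤ 2 * i ∧ 2 * (i + d) ≤ b m).card := by
  intro i d hd
  have hker : ∀ y ∈ pers k H T f Δ i d, ∃ (x : H i)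
      (hx : ∀ e ≤ d, compF k H f i e x ∈ LinearMap.ker (Δ (i + e))), compF k H f i d x = y := by
    rintro y ⟨x, hx, rfl⟩
    refine ⟨x, fun e he => ?_, rfl⟩
    simpa using (Submodule.mem_iInf _).1 hx ⟨e, Nat.lt_succ_of_le he⟩
  have hle : pers k H T f Δ i d ≤ LinearMap.ker (Δ (i + d)) := by
    intro y hy
    obtain ⟨x, hx, rfl⟩ := hker y hy
    exact hx d le_rfl
  let bars := {m : Fin M // a m ≤ 2 * i ∧ 2 * (i + d) ≤ b m}
  let toSlot : bars → {m : Fin M // a m ≤ 2 * (i + d) ∧ 2 * (i + d) ≤ b m} :=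
    fun m => ⟨m.1, by have := m.2.1; omega, m.2.2⟩
  let g : pers k H T f Δ i d →ₗ[k] (bars → k) :=
    LinearMap.funLeft k k toSlot ∘ₗ (φV (i + d) hd).toLinearMap ∘ₗ Submodule.inclusion hle
  have hg : Function.Injective g := by
    rw [injective_iff_map_eq_zero]
    rintro ⟨y, hy⟩ hgy
    obtain ⟨x, hx, rfl⟩ := hker y hy
    have hzero : φV (i + d) hd ⟨compF k H f i d x, hx d le_rfl⟩ = 0 := by
      funext m
      rcases le_or_gt (a m.1) (2 * i) with hm | hm
      · exact congrFun hgy ⟨m.1, hm, m.2.2⟩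
      · exact coord_compF_eq_zero k H T N f Δ M a b hab φV φW hback hfwd i x d hd hx m hm
    rw [LinearEquiv.map_eq_zero_iff] at hzero
    exact Subtype.ext (Subtype.ext_iff.1 hzero :)
  refine (LinearMap.finrank_le_finrank_of_injective hg).trans_eq ?_
  rw [Module.finrank_fintype_fun_eq_card, Fintype.card_subtype]
end

section
/- Suppose the kernel zigzag module associated to the data (H_i, f_i, Δ_i) is isomorphic, as a zigzag module, to a finite direct sum ⊕_{m∈M} I[a_m, b_m] of interval modules. Then for all 0 ≤ i ≤ j ≤ N, dim_k P^{i,j} ≥ #{m ∈ M : a_m ≤ 2i and b_m ≥ 2j}. -/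
/-!
Setting: a field `k`, finite-dimensional `k`-vector spaces `H 0, …, H N` with
linear maps `f i : H i → H (i+1)`, and for each `i` a linear map
`Δ i : H i → T i`.

`compF f i d : H i →ₗ H (i+d)` is the composite `f^{i,i+d}`, and `pers f Δ i d`
is the `Δ`-persistent group
`P^{i,i+d} = f^{i,i+d}( ⋂_{e=0}^{d} ker (Δ_{i+e} ∘ f^{i,i+e}) ) ⊆ H (i+d)`.

The kernel zigzag module is
`V 0 ←ι− W 0 −→ V 1 ←ι− W 1 −→ ⋯ −→ V N`, where `V i = ker Δ_i`,
`W i = ker Δ_i ⊓ ker (Δ_{i+1} ∘ f_i)`, the backward maps are the inclusions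
`W i ⊆ V i` and the forward maps are the restrictions of `f i`.  Its `2N+1`
slots are indexed by `0, …, 2N`, slot `2i` being `V i` and slot `2i+1` being
`W i`.

A finite direct sum of interval modules `⊕_{m} I[a m, b m]` is encoded
slot-wise: its value at slot `s` is `IntervalSlot k M a b s`, the space of
functions `{m // a m ≤ s ∧ s ≤ b m} → k`, and its connecting map between
adjacent slots `s` and `t` is `intervalMap k M a b s t`, which is the identity
on the component of each `m` whose interval `[a m, b m]` contains both slots,
and zero otherwise.

An isomorphism of zigzag modules is a family of linear isomorphisms, one at
each slot, commuting with all connecting maps.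
-/

variable (k : Type*) [Field k]

variable (H : ℕ → Type*) [∀ i, AddCommGroup (H i)] [∀ i, Module k (H i)]
  [∀ i, FiniteDimensional k (H i)]
variable (T : ℕ → Type*) [∀ i, AddCommGroup (T i)] [∀ i, Module k (T i)]

/-- The element of slot `s` of `⊕_{m} I[a m, b m]` obtained by restricting a family of
coefficients to the intervals containing `s`. -/
abbrev slotRestrict (k : Type*) [Field k] (M : ℕ) (a b : Fin M → ℕ) (s : ℕ) :
    (Fin M → k) →ₗ[k] IntervalSlot k M a b s :=
  LinearMap.funLeft k k Subtype.val

/-- A family of coefficients supported on intervals containing `s` is preserved by the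
connecting map out of slot `s`. -/
theorem intervalMap_slotRestrict {k : Type*} [Field k] {M : ℕ} {a b : Fin M → ℕ} {s : ℕ} (t : ℕ)
    {c : Fin M → k} (hc : ∀ m, c m ≠ 0 → a m ≤ s ∧ s ≤ b m) :
    intervalMap k M a b s t (slotRestrict k M a b s c) = slotRestrict k M a b t c := by
  funext m
  by_cases h : a m.1 ≤ s ∧ s ≤ b m.1
  · simp [intervalMap, LinearMap.funLeft_apply, h]
  · have : c m.1 = 0 := by
      by_contra h0
      exact h (hc _ h0)
    simp [intervalMap, LinearMap.funLeft_apply, h, this]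

/-- If the inclusion and the restriction of `f i` correspond to the connecting maps of
`⊕_{m} I[a m, b m]`, then `f i` carries a family of coefficients supported on intervals containing
slot `2 * i + 1` to the same family. -/
theorem map_symm_slotRestrict {k : Type*} [Field k]
    {H : ℕ → Type*} [∀ i, AddCommGroup (H i)] [∀ i, Module k (H i)]
    {T : ℕ → Type*} [∀ i, AddCommGroup (T i)] [∀ i, Module k (T i)]
    {f : ∀ i, H i →ₗ[k] H (i + 1)} {Δ : ∀ i, H i →ₗ[k] T i} {M : ℕ} {a b : Fin M → ℕ} {i : ℕ}
    (φ : ↥(LinearMap.ker (Δ i)) ≃ₗ[k] IntervalSlot k M a b (2 * i))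
    (φ' : ↥(LinearMap.ker (Δ (i + 1))) ≃ₗ[k] IntervalSlot k M a b (2 * (i + 1)))
    (ψ : ↥(Wsub k H T f Δ i) ≃ₗ[k] IntervalSlot k M a b (2 * i + 1))
    (hback : φ.toLinearMap ∘ₗ inclWV k H T f Δ i =
      intervalMap k M a b (2 * i + 1) (2 * i) ∘ₗ ψ.toLinearMap)
    (hfwd : φ'.toLinearMap ∘ₗ fresWV k H T f Δ i =
      intervalMap k M a b (2 * i + 1) (2 * (i + 1)) ∘ₗ ψ.toLinearMap)
    {c : Fin M → k} (hc : ∀ m, c m ≠ 0 → a m ≤ 2 * i + 1 ∧ 2 * i + 1 ≤ b m) :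
    f i (φ.symm (slotRestrict k M a b (2 * i) c)) =
      φ'.symm (slotRestrict k M a b (2 * (i + 1)) c) := by
  set w := ψ.symm (slotRestrict k M a b (2 * i + 1) c) with hw
  have h₁ : φ (inclWV k H T f Δ i w) = slotRestrict k M a b (2 * i) c := by
    rw [← intervalMap_slotRestrict (2 * i) hc]
    simpa [hw] using LinearMap.congr_fun hback w
  have h₂ : φ' (fresWV k H T f Δ i w) = slotRestrict k M a b (2 * (i + 1)) c := by
    rw [← intervalMap_slotRestrict (2 * (i + 1)) hc]
    simpa [hw] using LinearMap.congr_fun hfwd w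
  rw [← h₁, ← h₂, LinearEquiv.symm_apply_apply, LinearEquiv.symm_apply_apply]
  rfl

/-- if the kernel zigzag module is isomorphic, as a zigzag module,
to a finite direct sum `⊕_{m} I[a m, b m]` of interval modules, then for all
`0 ≤ i ≤ j ≤ N` (`j = i + d`), `dim_k P^{i,j}` is at least the number of `m` with
`a m ≤ 2i` and `b m ≥ 2j`,  -/
theorem finrank_pers_ge_card_bars
    (N : ℕ) (f : ∀ i, H i →ₗ[k] H (i + 1)) (Δ : ∀ i, H i →ₗ[k] T i)
    (M : ℕ) (a b : Fin M → ℕ) (hab : ∀ m, a m ≤ b m) (hb : ∀ m, b m ≤ 2 * N)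
    (φV : ∀ i, i ≤ N → (↥(LinearMap.ker (Δ i)) ≃ₗ[k] IntervalSlot k M a b (2 * i)))
    (φW : ∀ i, i < N → (↥(Wsub k H T f Δ i) ≃ₗ[k] IntervalSlot k M a b (2 * i + 1)))
    (hback : ∀ i (h : i < N),
      (φV i h.le).toLinearMap ∘ₗ inclWV k H T f Δ i =
        intervalMap k M a b (2 * i + 1) (2 * i) ∘ₗ (φW i h).toLinearMap)
    (hfwd : ∀ i (h : i < N),
      (φV (i + 1) h).toLinearMap ∘ₗ fresWV k H T f Δ i =
        intervalMap k M a b (2 * i + 1) (2 * i + 2) ∘ₗ (φW i h).toLinearMap) :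
    ∀ i d : ℕ, i + d ≤ N →
      (Finset.univ.filter fun m : Fin M => a m ≤ 2 * i ∧ 2 * (i + d) ≤ b m).card ≤
        Module.finrank k (pers k H T f Δ i d) := by
  intro i d hid
  let S := {m : Fin M // a m ≤ 2 * i ∧ 2 * (i + d) ≤ b m}
  let ext : (S → k) →ₗ[k] (Fin M → k) := Function.ExtendByZero.linearMap k Subtype.val
  have hext (c : S → k) (m : Fin M) (hm : ext c m ≠ 0) : a m ≤ 2 * i ∧ 2 * (i + d) ≤ b m := by
    by_contra h
    refine hm (Function.extend_apply' _ _ _ ?_)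
    rintro ⟨s, rfl⟩
    exact h s.2
  have hcomp (c : S → k) (e : ℕ) (he : e ≤ d) :
      compF k H f i e ((φV i (by omega)).symm (slotRestrict k M a b (2 * i) (ext c))) =
        (φV (i + e) (by omega)).symm (slotRestrict k M a b (2 * (i + e)) (ext c)) := by
    induction e with
    | zero => rfl
    | succ e ih =>
      rw [compF, LinearMap.comp_apply, ih (by omega)]
      refine map_symm_slotRestrict _ _ (φW (i + e) (by omega)) (hback _ _) (hfwd _ _) ?_
      intro m hm
      have := hext c m hm
      omega
  let L : (S → k) →ₗ[k] H (i + d) := (LinearMap.ker (Δ (i + d))).subtype ∘ₗ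
    (φV (i + d) hid).symm.toLinearMap ∘ₗ slotRestrict k M a b (2 * (i + d)) ∘ₗ ext
  have hL (c : S → k) : L c ∈ pers k H T f Δ i d := by
    refine ⟨_, ?_, hcomp c d le_rfl⟩
    simp only [SetLike.mem_coe, Submodule.mem_iInf, LinearMap.mem_ker, LinearMap.comp_apply]
    intro e
    rw [hcomp c e (by omega)]
    exact ((φV (i + e) _).symm _).2
  have hinj : Function.Injective L := by
    intro c c' h
    have h' := (φV (i + d) hid).symm.injective (Subtype.ext h)
    funext s
    have hs := congrFun h' ⟨s.1, by have := s.2; omega⟩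
    have happly (c : S → k) : ext c s.1 = c s := Subtype.val_injective.extend_apply _ _ _
    rwa [LinearMap.comp_apply, LinearMap.comp_apply, LinearMap.funLeft_apply,
      LinearMap.funLeft_apply, happly, happly] at hs
  have hle := LinearMap.finrank_le_finrank_of_injective
    (f := L.codRestrict (pers k H T f Δ i d) hL)
    (Function.Injective.of_comp (f := Subtype.val) hinj)
  rwa [Module.finrank_fintype_fun_eq_card, Fintype.card_subtype] at hle
end
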